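/- arXiv:1711.03018 — 5 statements merged into one kernel-verified Lean document; each statement's English description precedes it below -/
import Mathlib

section
/- Suppose the deterministic max-product system x_{k+1} = A ⊠ x_k is stable in the sense that for every initial condition the trajectory is bounded, and let λ ∈ ℝ₊^n be a vector with strictly positive entries. Then the function V(x) = sup_{k≥0} λ^T ⊠ A^k ⊠ x is finite for every x ∈ ℝ₊^n, satisfies V(0) = 0, and is non-increasing along every trajectory of the system: V(x_{k+1}) ≤ V(x_k) for all k. -/
open scoped NNReal ENNReal

/-- Max-product of a matrix over ℝ₊ = [0,∞) with a vector:
`(A ⊠ x)_i = max_j A_{ij} x_j`. -/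
noncomputable def mpMulVec {n m : ℕ} (A : Fin n → Fin m → ℝ≥0) (x : Fin m → ℝ≥0) :
    Fin n → ℝ≥0 :=
  fun i => Finset.univ.sup fun j => A i j * x j

/-- Max-product of two matrices: `(A ⊠ B)_{ij} = max_p A_{ip} B_{pj}`. -/
noncomputable def mpMul {n m l : ℕ} (A : Fin n → Fin m → ℝ≥0) (B : Fin m → Fin l → ℝ≥0) :
    Fin n → Fin l → ℝ≥0 :=
  fun i j => Finset.univ.sup fun p => A i p * B p j

/-- The max-product identity matrix. -/
noncomputable def mpId {n : ℕ} : Fin n → Fin n → ℝ≥0 :=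
  fun i j => if i = j then 1 else 0

/-- Max-product matrix powers: `A^0 = I`, `A^{k+1} = A^k ⊠ A`. -/
noncomputable def mpPow {n : ℕ} (A : Fin n → Fin n → ℝ≥0) : ℕ → Fin n → Fin n → ℝ≥0
  | 0 => mpId
  | k + 1 => mpMul (mpPow A k) A

/-- Max-product of a row vector with a vector: `λ^T ⊠ x = max_i λ_i x_i`. -/
noncomputable def mpDot {n : ℕ} (q x : Fin n → ℝ≥0) : ℝ≥0 :=
  Finset.univ.sup fun i => q i * x i

/-- Infinity norm of a nonnegative vector: `‖x‖ = max_i x_i`. -/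
noncomputable def vnorm {n : ℕ} (x : Fin n → ℝ≥0) : ℝ≥0 :=
  Finset.univ.sup x

/-- The trajectory of the deterministic max-product system `x_{k+1} = A ⊠ x_k`. -/
noncomputable def mpTraj {n : ℕ} (A : Fin n → Fin n → ℝ≥0) (x0 : Fin n → ℝ≥0) :
    ℕ → Fin n → ℝ≥0
  | 0 => x0
  | k + 1 => mpMulVec A (mpTraj A x0 k)

/-- The candidate Lyapunov function `V(x) = sup_{k ≥ 0} λ^T ⊠ A^k ⊠ x`
(taking the supremum in `[0,∞]`). -/
noncomputable def lyapV {n : ℕ} (A : Fin n → Fin n → ℝ≥0) (lam : Fin n → ℝ≥0)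
    (x : Fin n → ℝ≥0) : ℝ≥0∞ :=
  ⨆ k : ℕ, (mpDot lam (mpMulVec (mpPow A k) x) : ℝ≥0∞)

theorem mpMulVec_mpMul {n m l : ℕ} (A : Fin n → Fin m → ℝ≥0) (B : Fin m → Fin l → ℝ≥0)
    (x : Fin l → ℝ≥0) : mpMulVec (mpMul A B) x = mpMulVec A (mpMulVec B x) := by
  funext i
  simp only [mpMulVec, mpMul, NNReal.finset_sup_mul, NNReal.mul_finset_sup, mul_assoc]
  exact Finset.sup_comm _ _ _

theorem mpMulVec_mpId {n : ℕ} (x : Fin n → ℝ≥0) : mpMulVec mpId x = x := by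
  funext i
  refine le_antisymm (Finset.sup_le fun j _ => ?_) ?_
  · by_cases h : i = j <;> simp [mpId, h]
  · simpa [mpMulVec, mpId] using Finset.le_sup (f := fun j => mpId i j * x j) (Finset.mem_univ i)

theorem mpTraj_mpMulVec {n : ℕ} (A : Fin n → Fin n → ℝ≥0) (x : Fin n → ℝ≥0) (k : ℕ) :
    mpTraj A (mpMulVec A x) k = mpTraj A x (k + 1) := by
  induction k with
  | zero => rfl
  | succ k ih => exact congrArg (mpMulVec A) ih

theorem mpMulVec_mpPow {n : ℕ} (A : Fin n → Fin n → ℝ≥0) (x : Fin n → ℝ≥0) (k : ℕ) :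
    mpMulVec (mpPow A k) x = mpTraj A x k := by
  induction k generalizing x with
  | zero => exact mpMulVec_mpId x
  | succ k ih => rw [mpPow, mpMulVec_mpMul, ih, mpTraj_mpMulVec]

theorem mpMulVec_zero {n m : ℕ} (A : Fin n → Fin m → ℝ≥0) : mpMulVec A 0 = 0 := by
  funext i
  exact le_antisymm (Finset.sup_le fun j _ => by simp) zero_le

theorem mpDot_zero {n : ℕ} (q : Fin n → ℝ≥0) : mpDot q 0 = 0 :=
  le_antisymm (Finset.sup_le fun i _ => by simp) zero_le

theorem mpDot_le_vnorm_mul {n : ℕ} (q x : Fin n → ℝ≥0) : mpDot q x ≤ vnorm q * vnorm x :=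
  Finset.sup_le fun _ hi => mul_le_mul' (Finset.le_sup hi) (Finset.le_sup hi)

theorem lyapV_mpMulVec_le {n : ℕ} (A : Fin n → Fin n → ℝ≥0) (lam x : Fin n → ℝ≥0) :
    lyapV A lam (mpMulVec A x) ≤ lyapV A lam x := by
  refine iSup_le fun k => ?_
  rw [← mpMulVec_mpMul]
  exact le_iSup (fun k => (mpDot lam (mpMulVec (mpPow A k) x) : ℝ≥0∞)) (k + 1)

/-- If the system `x_{k+1} = A ⊠ x_k` is stable in the sense that every
trajectory is bounded, and `λ` has strictly positive entries, then
`V(x) = sup_{k≥0} λ^T ⊠ A^k ⊠ x` is finite for every `x`, vanishes at `x = 0`,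
and is non-increasing along every trajectory. -/
theorem lyapV_finite_zero_nonincreasing {n : ℕ} (A : Fin n → Fin n → ℝ≥0)
    (lam : Fin n → ℝ≥0) (hlam : ∀ i, 0 < lam i)
    (hstab : ∀ x0 : Fin n → ℝ≥0, ∃ B : ℝ≥0, ∀ k : ℕ, vnorm (mpTraj A x0 k) ≤ B) :
    (∀ x : Fin n → ℝ≥0, lyapV A lam x < ⊤) ∧
    lyapV A lam (0 : Fin n → ℝ≥0) = 0 ∧
    (∀ (x0 : Fin n → ℝ≥0) (k : ℕ),
      lyapV A lam (mpTraj A x0 (k + 1)) ≤ lyapV A lam (mpTraj A x0 k)) := by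
  refine ⟨fun x => ?_, ?_, fun x0 k => lyapV_mpMulVec_le A lam (mpTraj A x0 k)⟩
  · obtain ⟨B, hB⟩ := hstab x
    refine lt_of_le_of_lt (iSup_le fun k => ?_) (ENNReal.coe_lt_top (r := vnorm lam * B))
    rw [mpMulVec_mpPow]
    exact ENNReal.coe_le_coe.2
      ((mpDot_le_vnorm_mul _ _).trans (mul_le_mul_right (hB k) _))
  · simp [lyapV, mpMulVec_zero, mpDot_zero]
end

section
/- Consider the max-product system with Markovian jumps x_{k+1} = A(y_k) ⊠ x_k, x_0 ∈ ℝ₊^n, where y_k is a Markov chain on {1,…,M} with transition probabilities c_{ij} = P(y_{k+1}=j | y_k=i) and A(1),…,A(M) ∈ ℝ₊^{n×n}. Assume there exist a constant a > 1 and vectors p(1),…,p(M) with strictly positive entries such that a · Σ_{j=1}^M c_{ij} (p(j)^T ⊠ A(i) ⊠ v) ≤ p(i)^T ⊠ v for every vector v ∈ ℝ₊^n with positive entries and every i. Then the system is mean norm exponentially stable and almost surely stable. -/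
open scoped NNReal ENNReal
open MeasureTheory Filter

/-- `y` is a (time-homogeneous) Markov chain on `{1,…,M}` with transition probabilities
`c i j = P(y_{k+1} = j | y_k = i)`: each `y k` is measurable and for any time `k`, any path
`s 0, …, s k` and any `j`, `P(y_0 = s 0, …, y_k = s k, y_{k+1} = j)
 = c (s k) j * P(y_0 = s 0, …, y_k = s k)`. -/
def IsMarkovChain {Ω : Type*} [MeasurableSpace Ω] (P : Measure Ω) {M : ℕ}
    (y : ℕ → Ω → Fin M) (c : Fin M → Fin M → ℝ≥0) : Prop :=
  (∀ k, Measurable (y k)) ∧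
  ∀ (k : ℕ) (s : ℕ → Fin M) (j : Fin M),
    P {ω | (∀ t ≤ k, y t ω = s t) ∧ y (k + 1) ω = j}
      = (c (s k) j : ℝ≥0∞) * P {ω | ∀ t ≤ k, y t ω = s t}

/-- The random trajectory of the Markov-jump max-product system
`x_{k+1} = A(y_k) ⊠ x_k`, `x_0` deterministic. -/
noncomputable def mjTraj {Ω : Type*} {n M : ℕ} (A : Fin M → Fin n → Fin n → ℝ≥0)
    (y : ℕ → Ω → Fin M) (x0 : Fin n → ℝ≥0) : ℕ → Ω → Fin n → ℝ≥0
  | 0 => fun _ => x0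
  | k + 1 => fun ω => mpMulVec (A (y k ω)) (mjTraj A y x0 k ω)

/-- Mean norm exponential stability of `x_{k+1} = A(y_k) ⊠ x_k`: there are `a > 1`, `L > 0`
with `E[‖x_k‖] ≤ L ‖x_0‖ / a^k` for all `k` and all initial conditions. -/
def MeanNormExpStable {Ω : Type*} [MeasurableSpace Ω] (P : Measure Ω) {n M : ℕ}
    (A : Fin M → Fin n → Fin n → ℝ≥0) (y : ℕ → Ω → Fin M) : Prop :=
  ∃ a L : ℝ≥0, 1 < a ∧ 0 < L ∧
    ∀ (x0 : Fin n → ℝ≥0) (k : ℕ),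
      ∫⁻ ω, (vnorm (mjTraj A y x0 k ω) : ℝ≥0∞) ∂P ≤ (L * vnorm x0 : ℝ≥0) / (a : ℝ≥0∞) ^ k

theorem continuous_mpMulVec {n m : ℕ} (A : Fin n → Fin m → ℝ≥0) : Continuous (mpMulVec A) := by
  unfold mpMulVec
  exact continuous_pi fun i => Continuous.finset_sup_apply fun j _ => by fun_prop

theorem continuous_mpDot {n : ℕ} (q : Fin n → ℝ≥0) : Continuous (mpDot q) := by
  unfold mpDot
  exact Continuous.finset_sup_apply fun j _ => by fun_prop

/-- A Lyapunov inequality on positive vectors extends to all nonnegative vectors. -/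
theorem lyapunov_of_forall_pos {n M : ℕ} {B : Fin n → Fin n → ℝ≥0} {w : Fin M → ℝ≥0} {a : ℝ≥0}
    {p : Fin M → Fin n → ℝ≥0} {q : Fin n → ℝ≥0}
    (h : ∀ v : Fin n → ℝ≥0, (∀ s, 0 < v s) →
      a * ∑ j, w j * mpDot (p j) (mpMulVec B v) ≤ mpDot q v) (v : Fin n → ℝ≥0) :
    a * ∑ j, w j * mpDot (p j) (mpMulVec B v) ≤ mpDot q v := by
  have hdense : v ∈ closure {u : Fin n → ℝ≥0 | ∀ s, 0 < u s} := by
    have hlim : Tendsto (fun (ε : ℝ≥0) s => v s + ε) (nhdsWithin 0 (Set.Ioi 0)) (nhds v) := by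
      have hc : Continuous (fun (ε : ℝ≥0) s => v s + ε) := by fun_prop
      have := hc.tendsto 0
      simp only [add_zero] at this
      exact this.mono_left nhdsWithin_le_nhds
    refine mem_closure_of_tendsto hlim ?_
    filter_upwards [self_mem_nhdsWithin] with ε hε s
    exact add_pos_of_nonneg_of_pos zero_le (Set.mem_Ioi.1 hε)
  have hclosed : IsClosed {u : Fin n → ℝ≥0 |
      a * ∑ j, w j * mpDot (p j) (mpMulVec B u) ≤ mpDot q u} := by
    refine isClosed_le (continuous_const.mul (continuous_finsetSum _ fun j _ =>
      continuous_const.mul ?_)) (continuous_mpDot q)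
    exact (continuous_mpDot (p j)).comp (continuous_mpMulVec B)
  exact closure_minimal (fun u hu => h u hu) hclosed hdense

theorem mpDot_le_mul_vnorm {n : ℕ} {q : Fin n → ℝ≥0} {b : ℝ≥0} (hq : ∀ r, q r ≤ b)
    (x : Fin n → ℝ≥0) : mpDot q x ≤ b * vnorm x :=
  Finset.sup_le fun r _ =>
    mul_le_mul' (hq r) (Finset.le_sup (f := x) (Finset.mem_univ r))

theorem vnorm_le_mul_mpDot {n : ℕ} {q : Fin n → ℝ≥0} {b : ℝ≥0} (hpos : ∀ r, 0 < q r)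
    (hq : ∀ r, (q r)⁻¹ ≤ b) (x : Fin n → ℝ≥0) : vnorm x ≤ b * mpDot q x :=
  Finset.sup_le fun r _ =>
    calc x r = (q r)⁻¹ * (q r * x r) := by rw [inv_mul_cancel_left₀ (hpos r).ne']
      _ ≤ b * mpDot q x :=
        mul_le_mul' (hq r) (Finset.le_sup (f := fun i => q i * x i) (Finset.mem_univ r))

/-- Extension of a finite path to an infinite one by repeating its last state. -/
def extendPath {M : ℕ} (k : ℕ) (s : Fin (k + 1) → Fin M) : ℕ → Fin M :=
  fun t => s ⟨min t k, by omega⟩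

theorem mjTraj_eq_of_agree {Ω Ω' : Type*} {n M : ℕ} (A : Fin M → Fin n → Fin n → ℝ≥0)
    (y : ℕ → Ω → Fin M) (z : ℕ → Ω' → Fin M) (x0 : Fin n → ℝ≥0) (ω : Ω) (ω' : Ω') (k : ℕ)
    (h : ∀ t < k, y t ω = z t ω') : mjTraj A y x0 k ω = mjTraj A z x0 k ω' := by
  induction k with
  | zero => rfl
  | succ k ih =>
    simp only [mjTraj]
    rw [ih fun t ht => h t (by omega), h k (by omega)]

/-- The state at a time `i ≤ k + 1` is a function of the path up to time `k`. -/
theorem mjTraj_eq_extendPath {Ω : Type*} {n M : ℕ} (A : Fin M → Fin n → Fin n → ℝ≥0)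
    (y : ℕ → Ω → Fin M) (x0 : Fin n → ℝ≥0) {i k : ℕ} (hik : i ≤ k + 1) (ω : Ω) :
    mjTraj A y x0 i ω =
      mjTraj A (fun t s => s t) x0 i (extendPath k fun t : Fin (k + 1) => y t ω) := by
  refine mjTraj_eq_of_agree A y (fun t (s : ℕ → Fin M) => s t) x0 ω _ i fun t ht => ?_
  have : min t k = t := by omega
  simp [extendPath, this]

theorem measurable_path {Ω : Type*} [MeasurableSpace Ω] {M : ℕ} {y : ℕ → Ω → Fin M}
    (hy : ∀ k, Measurable (y k)) (k : ℕ) :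
    Measurable fun ω => fun t : Fin (k + 1) => y t ω :=
  measurable_pi_lambda _ fun t => hy t

theorem measurable_mjTraj {Ω : Type*} [MeasurableSpace Ω] {n M : ℕ}
    (A : Fin M → Fin n → Fin n → ℝ≥0) {y : ℕ → Ω → Fin M} (hy : ∀ k, Measurable (y k))
    (x0 : Fin n → ℝ≥0) (k : ℕ) : Measurable (mjTraj A y x0 k) := by
  rw [funext (mjTraj_eq_extendPath A y x0 k.le_succ)]
  exact (measurable_of_finite fun s => mjTraj A (fun t (s : ℕ → Fin M) => s t) x0 k
    (extendPath k s)).comp (measurable_path hy k)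

theorem lintegral_comp_fintype {Ω α : Type*} [MeasurableSpace Ω] (P : Measure Ω) [Fintype α]
    [MeasurableSpace α] [MeasurableSingletonClass α] {π : Ω → α} (hπ : Measurable π)
    (H : α → ℝ≥0∞) : ∫⁻ ω, H (π ω) ∂P = ∑ s, H s * P (π ⁻¹' {s}) := by
  rw [← lintegral_map (measurable_of_finite H) hπ, lintegral_fintype]
  exact Finset.sum_congr rfl fun s _ => by rw [Measure.map_apply hπ (measurableSet_singleton s)]

/-- Markov property in integrated form: conditioning on the path up to time `k`. -/
theorem IsMarkovChain.lintegral_succ {Ω : Type*} [MeasurableSpace Ω] {P : Measure Ω} {M : ℕ}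
    {y : ℕ → Ω → Fin M} {c : Fin M → Fin M → ℝ≥0} (hmc : IsMarkovChain P y c) (k : ℕ)
    (H : (Fin (k + 1) → Fin M) → Fin M → ℝ≥0∞) :
    ∫⁻ ω, H (fun t => y t ω) (y (k + 1) ω) ∂P =
      ∫⁻ ω, ∑ j, (c (y k ω) j : ℝ≥0∞) * H (fun t => y t ω) j ∂P := by
  have hπ := measurable_path hmc.1 k
  have hlast : ∀ ω, y k ω = (fun t : Fin (k + 1) => y t ω) (Fin.last k) := fun ω => rfl
  have hpath : ∀ (s : Fin (k + 1) → Fin M) (ω : Ω),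
      (∀ t ≤ k, y t ω = extendPath k s t) ↔ (fun t : Fin (k + 1) => y t ω) = s := by
    intro s ω
    constructor
    · intro h
      funext t
      have ht : min (t : ℕ) k = t := by omega
      simpa [extendPath, ht] using h t (by omega)
    · rintro rfl t ht
      simp [extendPath, ht]
  have hstep : ∀ s j,
      P ((fun ω => ((fun t : Fin (k + 1) => y t ω), y (k + 1) ω)) ⁻¹' {(s, j)}) =
        c (s (Fin.last k)) j * P ((fun ω => fun t : Fin (k + 1) => y t ω) ⁻¹' {s}) := by
    intro s j
    have h := hmc.2 k (extendPath k s) j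
    simp only [hpath] at h
    have hk : extendPath k s k = s (Fin.last k) := by simp [extendPath, Fin.last]
    rw [hk] at h
    convert h using 2
    · ext ω
      simp
    · rfl
  rw [lintegral_comp_fintype P (hπ.prodMk (hmc.1 (k + 1))) fun z => H z.1 z.2,
    Fintype.sum_prod_type]
  simp only [hlast]
  rw [lintegral_comp_fintype P hπ fun s => ∑ j, (c (s (Fin.last k)) j : ℝ≥0∞) * H s j]
  refine Finset.sum_congr rfl fun s _ => ?_
  rw [Finset.sum_mul]
  refine Finset.sum_congr rfl fun j _ => ?_
  rw [hstep, mul_comm (c _ j : ℝ≥0∞) (H s j), mul_assoc]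

/-- The expected Lyapunov function decays geometrically along trajectories. -/
theorem pow_mul_lintegral_mpDot_le {Ω : Type*} [MeasurableSpace Ω] {P : Measure Ω}
    {n M : ℕ} {A : Fin M → Fin n → Fin n → ℝ≥0} {c : Fin M → Fin M → ℝ≥0}
    {y : ℕ → Ω → Fin M} (hmc : IsMarkovChain P y c) {a : ℝ≥0} {p : Fin M → Fin n → ℝ≥0}
    (hlyap : ∀ (i : Fin M) (v : Fin n → ℝ≥0),
      a * ∑ j, c i j * mpDot (p j) (mpMulVec (A i) v) ≤ mpDot (p i) v)
    (x0 : Fin n → ℝ≥0) (k : ℕ) :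
    (a : ℝ≥0∞) ^ k * ∫⁻ ω, (mpDot (p (y k ω)) (mjTraj A y x0 k ω) : ℝ≥0∞) ∂P ≤
      ∫⁻ ω, (mpDot (p (y 0 ω)) x0 : ℝ≥0∞) ∂P := by
  induction k with
  | zero => simp [mjTraj]
  | succ k ih =>
    refine le_trans ?_ ih
    rw [pow_succ, mul_assoc]
    gcongr
    have h := hmc.lintegral_succ k fun s j =>
      (mpDot (p j) (mjTraj A (fun t (s : ℕ → Fin M) => s t) x0 (k + 1) (extendPath k s)) : ℝ≥0∞)
    simp only [← mjTraj_eq_extendPath A y x0 le_rfl] at h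
    rw [h, ← lintegral_const_mul' _ _ ENNReal.coe_ne_top]
    refine lintegral_mono fun ω => ?_
    simp only [mjTraj]
    exact_mod_cast hlyap (y k ω) (mjTraj A y x0 k ω)

/-- Geometric decay of the mean norm implies almost sure convergence to zero. -/
theorem ae_tendsto_zero_of_lintegral_vnorm_le {Ω : Type*} [MeasurableSpace Ω] {P : Measure Ω}
    {n : ℕ} {x : ℕ → Ω → Fin n → ℝ≥0} (hx : ∀ k, Measurable (x k)) {a C : ℝ≥0} (ha : 1 < a)
    (h : ∀ k, ∫⁻ ω, (vnorm (x k ω) : ℝ≥0∞) ∂P ≤ C / (a : ℝ≥0∞) ^ k) :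
    ∀ᵐ ω ∂P, Tendsto (fun k => x k ω) atTop (nhds 0) := by
  have hcont : Continuous (vnorm : (Fin n → ℝ≥0) → ℝ≥0) := by
    unfold vnorm
    exact Continuous.finset_sup_apply fun j _ => by fun_prop
  have hmeas : ∀ k, Measurable fun ω => (vnorm (x k ω) : ℝ≥0∞) := fun k =>
    (hcont.measurable.comp (hx k)).coe_nnreal_ennreal
  have hsum : ∫⁻ ω, ∑' k, (vnorm (x k ω) : ℝ≥0∞) ∂P ≠ ⊤ := by
    rw [lintegral_tsum fun k => (hmeas k).aemeasurable]
    refine ne_top_of_le_ne_top ?_ (ENNReal.tsum_le_tsum h)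
    simp only [div_eq_mul_inv, ENNReal.inv_pow]
    rw [ENNReal.tsum_mul_left, ENNReal.tsum_geometric]
    refine ENNReal.mul_ne_top ENNReal.coe_ne_top (ENNReal.inv_ne_top.2 ?_)
    exact (tsub_pos_of_lt (ENNReal.inv_lt_one.2 (by exact_mod_cast ha))).ne'
  filter_upwards [ae_lt_top (Measurable.tsum hmeas) hsum] with ω hω
  have hlim : Tendsto (fun k => vnorm (x k ω)) atTop (nhds 0) :=
    NNReal.tendsto_atTop_zero_of_summable (ENNReal.tsum_coe_ne_top_iff_summable.1 hω.ne)
  refine tendsto_pi_nhds.2 fun r => ?_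
  exact tendsto_of_tendsto_of_tendsto_of_le_of_le tendsto_const_nhds hlim
    (fun k => zero_le) fun k => Finset.le_sup (f := x k ω) (Finset.mem_univ r)

/-- if there are `a > 1` and vectors `p(1), …, p(M)` with strictly positive
entries such that `a · Σ_j c_{ij} (p(j)^T ⊠ A(i) ⊠ v) ≤ p(i)^T ⊠ v` for every positive
vector `v` and every `i`, then the Markov-jump max-product system
`x_{k+1} = A(y_k) ⊠ x_k` is mean norm exponentially stable and almost surely stable. -/
theorem stable_of_stochastic_lyapunov {Ω : Type*} [MeasurableSpace Ω] (P : Measure Ω)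
    [IsProbabilityMeasure P] {n M : ℕ} (A : Fin M → Fin n → Fin n → ℝ≥0)
    (c : Fin M → Fin M → ℝ≥0) (y : ℕ → Ω → Fin M)
    (hmc : IsMarkovChain P y c) (hrow : ∀ i, ∑ j, c i j = 1)
    (a : ℝ≥0) (ha : 1 < a) (p : Fin M → Fin n → ℝ≥0) (hp : ∀ i r, 0 < p i r)
    (hlyap : ∀ (i : Fin M) (v : Fin n → ℝ≥0), (∀ s, 0 < v s) →
      a * ∑ j, c i j * mpDot (p j) (mpMulVec (A i) v) ≤ mpDot (p i) v) :
    MeanNormExpStable P A y ∧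
      ∀ x0 : Fin n → ℝ≥0,
        ∀ᵐ ω ∂P, Tendsto (fun k => mjTraj A y x0 k ω) atTop (nhds 0) := by
  obtain ⟨b, hb⟩ := Finite.exists_le fun ir : Fin M × Fin n => p ir.1 ir.2
  obtain ⟨d, hd⟩ := Finite.exists_le fun ir : Fin M × Fin n => (p ir.1 ir.2)⁻¹
  have ha0 : (a : ℝ≥0∞) ≠ 0 := by exact_mod_cast (zero_lt_one.trans ha).ne'
  have hmean : ∀ (x0 : Fin n → ℝ≥0) (k : ℕ),
      ∫⁻ ω, (vnorm (mjTraj A y x0 k ω) : ℝ≥0∞) ∂P ≤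
        ((d * b + 1) * vnorm x0 : ℝ≥0) / (a : ℝ≥0∞) ^ k := by
    intro x0 k
    rw [ENNReal.le_div_iff_mul_le (.inl (pow_ne_zero _ ha0))
      (.inl (ENNReal.pow_ne_top ENNReal.coe_ne_top)), mul_comm]
    calc (a : ℝ≥0∞) ^ k * ∫⁻ ω, (vnorm (mjTraj A y x0 k ω) : ℝ≥0∞) ∂P
        ≤ (a : ℝ≥0∞) ^ k *
            ∫⁻ ω, (d : ℝ≥0∞) * (mpDot (p (y k ω)) (mjTraj A y x0 k ω) : ℝ≥0∞) ∂P := by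
          gcongr with ω
          exact_mod_cast vnorm_le_mul_mpDot (hp _) (fun r => hd (y k ω, r)) _
      _ = d * ((a : ℝ≥0∞) ^ k *
            ∫⁻ ω, (mpDot (p (y k ω)) (mjTraj A y x0 k ω) : ℝ≥0∞) ∂P) := by
          rw [lintegral_const_mul' _ _ ENNReal.coe_ne_top, mul_left_comm]
      _ ≤ d * ∫⁻ ω, (mpDot (p (y 0 ω)) x0 : ℝ≥0∞) ∂P := by
          gcongr
          exact pow_mul_lintegral_mpDot_le hmc
            (fun i => lyapunov_of_forall_pos (hlyap i)) x0 k
      _ ≤ d * ∫⁻ _, ((b * vnorm x0 : ℝ≥0) : ℝ≥0∞) ∂P := by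
          gcongr with ω
          exact mpDot_le_mul_vnorm (fun r => hb (y 0 ω, r)) _
      _ ≤ ((d * b + 1) * vnorm x0 : ℝ≥0) := by
          rw [lintegral_const, measure_univ, mul_one, ← ENNReal.coe_mul, ENNReal.coe_le_coe,
            ← mul_assoc]
          gcongr
          exact le_self_add
  exact ⟨⟨a, d * b + 1, ha, by positivity, hmean⟩, fun x0 =>
    ae_tendsto_zero_of_lintegral_vnorm_le (measurable_mjTraj A hmc.1 x0) ha (hmean x0)⟩
end

section
/- Consider a system x̄_{t+1} = Ā(y_t, w_t) ⊠ x̄_t over ℝ₊^n, where y_t takes values in {1,…,M}, w_t takes values in {1,…,M̄}, (y_t, w_t) is a Markov chain, and w_t is conditionally independent of (w_{t-1}, y_{t-1}) given y_t; let c̃(i,j,i') = P(y_{t+1}=i', w_t=j | y_t=i). Let p(1),…,p(M) be vectors with strictly positive entries and V(x̄, y) = p(y)^T ⊠ x̄. Then for any δ with 0 < δ < 1 the following are equivalent: (i) E[V(x̄_{t+1}, y_{t+1}) | x̄_t, y_t] ≤ δ V(x̄_t, y_t) for all x̄_t ∈ ℝ₊^n and all y_t; (ii) Σ_{j=1}^{M̄}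 Σ_{i'=1}^M c̃(i,j,i') · (𝟙^T ⊠ Ã(i',i,j) ⊠ 𝟙) ≤ δ for every i = 1,…,M, where Ã(i',i,j) = diag(p(i')) · Ā(i,j) · diag(p(i)^{-1}) (usual matrix products with diagonal matrices, i.e. Ã_{rs} = p_r(i') Ā_{rs}(i,j) / p_s(i)). -/
open scoped NNReal

/-- `𝟙^T ⊠ A ⊠ 𝟙`, i.e. the maximum entry of a matrix. -/
noncomputable def maxEntry {n : ℕ} (A : Fin n → Fin n → ℝ≥0) : ℝ≥0 :=
  Finset.univ.sup fun r => Finset.univ.sup fun s => A r s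

theorem mpDot_mpMulVec_inv {n : ℕ} (q p : Fin n → ℝ≥0) (A : Fin n → Fin n → ℝ≥0) :
    mpDot q (mpMulVec A fun s => (p s)⁻¹) = maxEntry fun r s => q r * A r s * (p s)⁻¹ := by
  simp only [mpDot, mpMulVec, maxEntry, NNReal.mul_finset_sup, mul_assoc]

theorem mpDot_inv_self_le_one {n : ℕ} (p : Fin n → ℝ≥0) :
    mpDot p (fun s => (p s)⁻¹) ≤ 1 :=
  Finset.sup_le fun s _ => mul_inv_le_one (a := p s)

theorem le_maxEntry {n : ℕ} (A : Fin n → Fin n → ℝ≥0) (r s : Fin n) : A r s ≤ maxEntry A :=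
  (Finset.le_sup (f := fun s => A r s) (Finset.mem_univ s)).trans
    (Finset.le_sup (f := fun r => Finset.univ.sup fun s => A r s) (Finset.mem_univ r))

theorem mpDot_mpMulVec_le {n : ℕ} (q p : Fin n → ℝ≥0) (hp : ∀ s, 0 < p s)
    (A : Fin n → Fin n → ℝ≥0) (x : Fin n → ℝ≥0) :
    mpDot q (mpMulVec A x) ≤ (maxEntry fun r s => q r * A r s * (p s)⁻¹) * mpDot p x := by
  simp only [mpDot, mpMulVec, NNReal.mul_finset_sup]
  refine Finset.sup_le fun r _ => Finset.sup_le fun s _ => ?_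
  rw [← NNReal.mul_finset_sup]
  calc q r * (A r s * x s) = q r * A r s * (p s)⁻¹ * (p s * x s) := by
        have := (hp s).ne'
        field_simp
    _ ≤ _ := mul_le_mul' (le_maxEntry (fun r s => q r * A r s * (p s)⁻¹) r s)
        (Finset.le_sup (f := fun s => p s * x s) (Finset.mem_univ s))

/-- Lemma 2 of the paper. Consider the system `x̄_{t+1} = Ā(y_t, w_t) ⊠ x̄_t`,
where `(y_t, w_t)` is a Markov chain, `w_t` is conditionally independent of
`(w_{t-1}, y_{t-1})` given `y_t`, and `c̃(i,j,i') = P(y_{t+1} = i', w_t = j | y_t = i)`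
(so that `Σ_{j,i'} c̃(i,j,i') = 1` for each `i`).  Under these assumptions the conditional
expectation of `V(x̄_{t+1}, y_{t+1}) = p(y_{t+1})^T ⊠ x̄_{t+1}` given `x̄_t = x̄`, `y_t = i`
equals `Σ_{j,i'} c̃(i,j,i') · p(i')^T ⊠ Ā(i,j) ⊠ x̄`; hence, for `0 < δ < 1`, the following
are equivalent:
(i)  `E[V(x̄_{t+1}, y_{t+1}) | x̄_t = x̄, y_t = i] ≤ δ V(x̄, i)` for all `x̄ ∈ ℝ₊^n` and all `i`;
(ii) `Σ_{j=1}^{M̄} Σ_{i'=1}^M c̃(i,j,i') (𝟙^T ⊠ Ã(i',i,j) ⊠ 𝟙) ≤ δ` for every `i`,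
where `Ã(i',i,j) = diag(p(i')) Ā(i,j) diag(p(i)⁻¹)`,
i.e. `Ã(i',i,j)_{rs} = p(i')_r Ā(i,j)_{rs} (p(i)_s)⁻¹`. -/
theorem one_step_lyapunov_iff_maxEntry_cond {n M Mb : ℕ}
    (Abar : Fin M → Fin Mb → Fin n → Fin n → ℝ≥0)
    (ctil : Fin M → Fin Mb → Fin M → ℝ≥0)
    (hprob : ∀ i, ∑ j, ∑ i', ctil i j i' = 1)
    (p : Fin M → Fin n → ℝ≥0) (hp : ∀ i r, 0 < p i r)
    (δ : ℝ≥0) (hδ0 : 0 < δ) (hδ1 : δ < 1) :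
    (∀ (i : Fin M) (xb : Fin n → ℝ≥0),
        ∑ j, ∑ i', ctil i j i' * mpDot (p i') (mpMulVec (Abar i j) xb)
          ≤ δ * mpDot (p i) xb)
    ↔
    (∀ i : Fin M,
        ∑ j, ∑ i', ctil i j i' *
          maxEntry (fun r s => p i' r * Abar i j r s * (p i s)⁻¹) ≤ δ) := by
  constructor
  · intro h i
    calc _ = ∑ j, ∑ i', ctil i j i' *
          mpDot (p i') (mpMulVec (Abar i j) fun s => (p i s)⁻¹) := by
          simp only [mpDot_mpMulVec_inv]
      _ ≤ δ * mpDot (p i) fun s => (p i s)⁻¹ := h i _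
      _ ≤ δ := mul_le_of_le_one_right' (mpDot_inv_self_le_one (p i))
  · intro h i xb
    calc _ ≤ ∑ j, ∑ i', ctil i j i' *
          ((maxEntry fun r s => p i' r * Abar i j r s * (p i s)⁻¹) * mpDot (p i) xb) := by
          gcongr
          exact mpDot_mpMulVec_le _ _ (hp i) _ _
      _ = (∑ j, ∑ i', ctil i j i' *
          maxEntry fun r s => p i' r * Abar i j r s * (p i s)⁻¹) * mpDot (p i) xb := by
          simp only [Finset.sum_mul, mul_assoc]
      _ ≤ δ * mpDot (p i) xb := mul_le_mul_left (h i) _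
end

section
/- Consider the max-plus system with Markovian jumps x_{k+1} = A(y_k) ⊞ x_k, x_0 ∈ ℝ^n, where y_k is a Markov chain on {1,…,M}, and fix γ > 0. If the associated max-product system x'_{k+1} = A'(y_k) ⊠ x'_k with A'(y) = exp(A(y))/γ (componentwise exponentiation) is mean norm exponentially stable, then for almost every sample path of the max-plus system there exists K such that x_k < (k ln γ) 𝟙 componentwise for all k ≥ K. -/
open scoped NNReal ENNReal
open MeasureTheory Filter

/-- Max-plus product of a matrix over `ℝ ∪ {-∞}` with a real vector:
`(A ⊞ x)_i = max_j (A_{ij} + x_j)`. -/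
noncomputable def maxPlusVec {n m : ℕ} (A : Fin n → Fin m → WithBot ℝ) (x : Fin m → ℝ) :
    Fin n → WithBot ℝ :=
  fun i => Finset.univ.sup fun j => A i j + (x j : WithBot ℝ)

/-- Componentwise exponential `ℝ ∪ {-∞} → ℝ₊` with `exp(-∞) = 0`. -/
noncomputable def expb : WithBot ℝ → ℝ≥0 :=
  fun a => WithBot.recBotCoe 0 (fun r => (Real.exp r).toNNReal) a

theorem expb_bot : expb ⊥ = 0 := rfl

theorem expb_coe (r : ℝ) : expb (r : WithBot ℝ) = (Real.exp r).toNNReal := rfl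

theorem expb_add_coe (a : WithBot ℝ) (r : ℝ) :
    expb (a + (r : WithBot ℝ)) = expb a * expb (r : WithBot ℝ) := by
  induction a with
  | bot => simp [expb_bot]
  | coe s =>
    rw [← WithBot.coe_add, expb_coe, expb_coe, expb_coe, Real.exp_add,
      Real.toNNReal_mul (Real.exp_pos s).le]

theorem expb_mono : Monotone expb := by
  intro a b hab
  induction a with
  | bot => simp [expb_bot]
  | coe s =>
    induction b with
    | bot => simp at hab
    | coe t =>
      exact Real.toNNReal_le_toNNReal (Real.exp_le_exp.mpr (WithBot.coe_le_coe.mp hab))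

theorem expb_maxPlusVec {n m : ℕ} (A : Fin n → Fin m → WithBot ℝ) (x : Fin m → ℝ) (i : Fin n) :
    expb (maxPlusVec A x i) =
      mpMulVec (fun i j => expb (A i j)) (fun j => expb (x j : WithBot ℝ)) i := by
  unfold maxPlusVec mpMulVec
  rw [Finset.apply_sup_eq_sup_comp expb (fun a b => expb_mono.map_sup a b) expb_bot]
  exact Finset.sup_congr rfl fun j _ => expb_add_coe _ _

theorem mpMulVec_div_div {n m : ℕ} (A : Fin n → Fin m → ℝ≥0) (x : Fin m → ℝ≥0) (r s : ℝ≥0)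
    (i : Fin n) :
    mpMulVec (fun i j => A i j / r) (fun j => x j / s) i = mpMulVec A x i / (r * s) := by
  unfold mpMulVec
  rw [NNReal.finset_sup_div]
  exact Finset.sup_congr rfl fun j _ => div_mul_div_comm _ _ _ _

/-- Scaled componentwise exponentials of a max-plus trajectory form the trajectory of the
associated max-product system. -/
theorem mjTraj_eq_expb_div_pow {Ω : Type*} {n M : ℕ} (A : Fin M → Fin n → Fin n → WithBot ℝ)
    (y : ℕ → Ω → Fin M) (γ : ℝ≥0) (x0 : Fin n → ℝ) (x : ℕ → Ω → Fin n → ℝ)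
    (hx0 : ∀ ω, x 0 ω = x0)
    (hdyn : ∀ (k : ℕ) (ω : Ω) (i : Fin n),
      ((x (k + 1) ω i : ℝ) : WithBot ℝ) = maxPlusVec (A (y k ω)) (x k ω) i) (k : ℕ) (ω : Ω) :
    mjTraj (fun m i j => expb (A m i j) / γ) y (fun i => expb (x0 i : WithBot ℝ)) k ω =
      fun i => expb (x k ω i : WithBot ℝ) / γ ^ k := by
  induction k with
  | zero => simp [mjTraj, hx0]
  | succ k ih =>
    ext i
    simp only [mjTraj]
    rw [ih, mpMulVec_div_div, hdyn, expb_maxPlusVec, pow_succ']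

theorem measurable_vnorm {n : ℕ} : Measurable (vnorm : (Fin n → ℝ≥0) → ℝ≥0) :=
  (Continuous.finset_sup_apply fun j _ => continuous_apply j).measurable

/-- Mean norm exponential stability implies almost sure convergence to zero. -/
theorem MeanNormExpStable.ae_tendsto_zero {Ω : Type*} [MeasurableSpace Ω] {P : Measure Ω}
    {n M : ℕ} {A : Fin M → Fin n → Fin n → ℝ≥0} {y : ℕ → Ω → Fin M}
    (h : MeanNormExpStable P A y) (hy : ∀ k, Measurable (y k)) (x0 : Fin n → ℝ≥0) :
    ∀ᵐ ω ∂P, Tendsto (fun k => (vnorm (mjTraj A y x0 k ω) : ℝ≥0∞)) atTop (nhds 0) := by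
  obtain ⟨a, L, ha, -, hb⟩ := h
  have hm (k : ℕ) : Measurable fun ω => (vnorm (mjTraj A y x0 k ω) : ℝ≥0∞) :=
    (measurable_vnorm.comp (measurable_mjTraj A hy x0 k)).coe_nnreal_ennreal
  have hsum : ∑' k, ∫⁻ ω, (vnorm (mjTraj A y x0 k ω) : ℝ≥0∞) ∂P ≠ ∞ := by
    refine ne_top_of_le_ne_top ?_ (ENNReal.tsum_le_tsum (hb x0))
    simp only [div_eq_mul_inv, ENNReal.tsum_mul_left, ENNReal.inv_pow]
    rw [ENNReal.tsum_geometric]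
    refine ENNReal.mul_ne_top ENNReal.coe_ne_top (ENNReal.inv_ne_top.mpr ?_)
    rw [ne_eq, tsub_eq_zero_iff_le, not_le, ENNReal.inv_lt_one]
    exact_mod_cast ha
  rw [← lintegral_tsum fun k => (hm k).aemeasurable] at hsum
  filter_upwards [ae_lt_top (Measurable.tsum hm) hsum] with ω hω
  exact ENNReal.tendsto_atTop_zero_of_tsum_ne_top hω.ne

/-- Proposition 6 of the paper: consider the Markov-jump max-plus system
`x_{k+1} = A(y_k) ⊞ x_k`, `x_0 ∈ ℝⁿ`, and `γ > 0`.  If the associated max-product system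
`x'_{k+1} = A'(y_k) ⊠ x'_k` with `A'(y) = exp(A(y))/γ` is mean norm exponentially stable,
then almost every sample path eventually satisfies `x_k < (k ln γ) 𝟙` componentwise. -/
theorem maxPlus_as_bound_of_maxProd_stable {Ω : Type*} [MeasurableSpace Ω]
    (P : Measure Ω) [IsProbabilityMeasure P] {n M : ℕ}
    (A : Fin M → Fin n → Fin n → WithBot ℝ) (c : Fin M → Fin M → ℝ≥0)
    (y : ℕ → Ω → Fin M) (hmc : IsMarkovChain P y c) (hrow : ∀ i, ∑ j, c i j = 1)
    (γ : ℝ≥0) (hγ : 0 < γ)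
    (hstab : MeanNormExpStable P (fun m i j => expb (A m i j) / γ) y)
    (x0 : Fin n → ℝ) (x : ℕ → Ω → Fin n → ℝ)
    (hx0 : ∀ ω, x 0 ω = x0)
    (hdyn : ∀ (k : ℕ) (ω : Ω) (i : Fin n),
      ((x (k + 1) ω i : ℝ) : WithBot ℝ) = maxPlusVec (A (y k ω)) (x k ω) i) :
    ∀ᵐ ω ∂P, ∃ K : ℕ, ∀ k ≥ K, ∀ i : Fin n, x k ω i < k * Real.log (γ : ℝ) := by
  filter_upwards [hstab.ae_tendsto_zero hmc.1 fun i => expb (x0 i : WithBot ℝ)] with ω hω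
  obtain ⟨K, hK⟩ := eventually_atTop.mp (hω.eventually_lt_const one_pos)
  refine ⟨K, fun k hk i => ?_⟩
  have hlt := hK k hk
  rw [mjTraj_eq_expb_div_pow A y γ x0 x hx0 hdyn, ENNReal.coe_lt_one_iff] at hlt
  have hi : expb (x k ω i : WithBot ℝ) / γ ^ k < 1 :=
    (Finset.le_sup (f := fun i => expb (x k ω i : WithBot ℝ) / γ ^ k)
      (Finset.mem_univ i)).trans_lt hlt
  rw [div_lt_one (pow_pos hγ k), expb_coe, ← NNReal.coe_lt_coe,
    Real.coe_toNNReal _ (Real.exp_pos _).le, NNReal.coe_pow] at hi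
  rw [← Real.log_pow]
  exact (Real.lt_log_iff_exp_lt (pow_pos (NNReal.coe_pos.mpr hγ) k)).mpr hi
end

section
/- Consider the two-dimensional system over ℝ₊: x¹_{k+1} = max(0.96·x¹_k, 1.2·(x¹_k)^{0.15}(x²_k)^{0.85}), x²_{k+1} = max(0.76·(x¹_k)^{0.85}(x²_k)^{0.15}, 0.96·x²_k). The set {x ∈ ℝ₊² : x¹ ≤ 1 and x² ≤ 0.8} is invariant under these dynamics; i.e., if x¹_k ≤ 1 and x²_k ≤ 0.8 then x¹_{k+1} ≤ 1 and x²_{k+1} ≤ 0.8. Equivalently, the function V(x) = max(x¹, 1.25·x²) satisfies V(x_{k+1}) ≤ V(x_k) whenever V(x_k) ≤ 1, and by 1-homogeneity of the dynamics, for all x_k ∈ ℝ₊². -/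
open scoped NNReal

/-- The dynamics of the exponentiated system (47) of the paper:
`x¹_{k+1} = max(0.96 x¹, 1.2 (x¹)^{0.15} (x²)^{0.85})`,
`x²_{k+1} = max(0.76 (x¹)^{0.85} (x²)^{0.15}, 0.96 x²)`. -/
noncomputable def f1 (x1 x2 : ℝ≥0) : ℝ≥0 :=
  0.96 * x1 ⊔ 1.2 * x1 ^ (0.15 : ℝ) * x2 ^ (0.85 : ℝ)

noncomputable def f2 (x1 x2 : ℝ≥0) : ℝ≥0 :=
  0.76 * x1 ^ (0.85 : ℝ) * x2 ^ (0.15 : ℝ) ⊔ 0.96 * x2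

/-- This reduces to `1.2 ^ 20 * 0.8 ^ 17 ≤ 1`. -/
lemma mul_rpow_le_one : (1.2 : ℝ≥0) * 0.8 ^ (0.85 : ℝ) ≤ 1 := by
  have h : ((1.2 : ℝ≥0) * 0.8 ^ (0.85 : ℝ)) ^ 20 ≤ 1 := by
    have h17 : ((0.8 : ℝ≥0) ^ (0.85 : ℝ)) ^ 20 = 0.8 ^ 17 := by
      rw [← NNReal.rpow_mul_natCast, ← NNReal.rpow_natCast]
      norm_num
    rw [mul_pow, h17, ← NNReal.coe_le_coe]
    push_cast
    norm_num
  exact (pow_le_one_iff (by norm_num)).mp h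

lemma rpow_mul_rpow_of_add_eq_one (v : ℝ≥0) {a b : ℝ} (h : a + b = 1) :
    v ^ a * v ^ b = v := by
  rw [← NNReal.rpow_add' (by rw [h]; exact one_ne_zero), h, NNReal.rpow_one]

lemma f1_le {x1 x2 v : ℝ≥0} (h1 : x1 ≤ v) (h2 : x2 ≤ 0.8 * v) : f1 x1 x2 ≤ v := by
  refine sup_le ?_ ?_
  · calc 0.96 * x1 ≤ 1 * v := by
          gcongr
          rw [← NNReal.coe_le_coe]; push_cast; norm_num
      _ = v := one_mul v
  · calc 1.2 * x1 ^ (0.15 : ℝ) * x2 ^ (0.85 : ℝ)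
        ≤ 1.2 * v ^ (0.15 : ℝ) * (0.8 * v) ^ (0.85 : ℝ) := by gcongr
      _ = 1.2 * 0.8 ^ (0.85 : ℝ) * (v ^ (0.15 : ℝ) * v ^ (0.85 : ℝ)) := by
          rw [NNReal.mul_rpow]; ring
      _ = 1.2 * 0.8 ^ (0.85 : ℝ) * v := by
          rw [rpow_mul_rpow_of_add_eq_one v (by norm_num)]
      _ ≤ 1 * v := by gcongr; exact mul_rpow_le_one
      _ = v := one_mul v

lemma f2_le {x1 x2 v : ℝ≥0} (h1 : x1 ≤ v) (h2 : x2 ≤ 0.8 * v) : f2 x1 x2 ≤ 0.8 * v := by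
  have h08 : (0.8 : ℝ≥0) ≤ 1 := by
    rw [← NNReal.coe_le_coe]; push_cast; norm_num
  refine sup_le ?_ ?_
  · have h2' : x2 ≤ v := h2.trans (mul_le_of_le_one_left zero_le h08)
    calc 0.76 * x1 ^ (0.85 : ℝ) * x2 ^ (0.15 : ℝ)
        ≤ 0.76 * v ^ (0.85 : ℝ) * v ^ (0.15 : ℝ) := by gcongr
      _ = 0.76 * v := by
          rw [mul_assoc, rpow_mul_rpow_of_add_eq_one v (by norm_num)]
      _ ≤ 0.8 * v := by
          gcongr
          rw [← NNReal.coe_le_coe]; push_cast; norm_num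
  · refine (mul_le_of_le_one_left zero_le ?_).trans h2
    rw [← NNReal.coe_le_coe]; push_cast; norm_num

lemma lyapunov_le (x1 x2 : ℝ≥0) :
    f1 x1 x2 ⊔ 1.25 * f2 x1 x2 ≤ x1 ⊔ 1.25 * x2 := by
  set v := x1 ⊔ 1.25 * x2
  have hc : (1.25 : ℝ≥0) * 0.8 = 1 := by
    rw [← NNReal.coe_inj]; push_cast; norm_num
  have h1 : x1 ≤ v := le_sup_left
  have h2 : x2 ≤ 0.8 * v := by
    calc x2 = 0.8 * (1.25 * x2) := by rw [← mul_assoc, mul_comm 0.8, hc, one_mul]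
      _ ≤ 0.8 * v := by gcongr; exact le_sup_right
  refine sup_le (f1_le h1 h2) ?_
  calc 1.25 * f2 x1 x2 ≤ 1.25 * (0.8 * v) := by gcongr; exact f2_le h1 h2
    _ = v := by rw [← mul_assoc, hc, one_mul]

/-- the set `{x ∈ ℝ₊² : x¹ ≤ 1, x² ≤ 0.8}` is invariant under the dynamics
above; equivalently, `V(x) = max(x¹, 1.25 x²)` satisfies `V(x_{k+1}) ≤ V(x_k)` whenever
`V(x_k) ≤ 1` and hence, by 1-homogeneity of the dynamics, for all `x_k ∈ ℝ₊²`. -/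
theorem example_invariant_and_lyapunov :
    (∀ x1 x2 : ℝ≥0, x1 ≤ 1 → x2 ≤ 0.8 → f1 x1 x2 ≤ 1 ∧ f2 x1 x2 ≤ 0.8) ∧
    (∀ x1 x2 : ℝ≥0, x1 ⊔ 1.25 * x2 ≤ 1 →
      f1 x1 x2 ⊔ 1.25 * f2 x1 x2 ≤ x1 ⊔ 1.25 * x2) ∧
    (∀ x1 x2 : ℝ≥0, f1 x1 x2 ⊔ 1.25 * f2 x1 x2 ≤ x1 ⊔ 1.25 * x2) := by
  refine ⟨fun x1 x2 h1 h2 => ?_, fun x1 x2 _ => lyapunov_le x1 x2, lyapunov_le⟩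
  rw [← mul_one (0.8 : ℝ≥0)] at h2 ⊢
  exact ⟨f1_le h1 h2, f2_le h1 h2⟩
end
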